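/- arXiv:2405.04171 — 5 statements merged into one kernel-verified Lean document; each statement's English description precedes it below -/
import Mathlib

section
/- For any sequence of vectors w^{(1)}, …, w^{(t)} in ℝ^d such that each w^{(s)} lies in the linear span of e_1, …, e_{s−1} (in particular w^{(1)} = 0), one has min_{1≤s≤t} ‖∇F(w^{(s)})‖² ≥ 6L(F(w^{(1)}) − F*)/(t(2t+1)²). -/
/-- The quadratic-form matrix of the Nesterov function: the `(2t+1) × (2t+1)` discrete
Dirichlet Laplacian, padded with zeros to size `d`. -/
def nesterovMatrix (d t : ℕ) : Matrix (Fin d) (Fin d) ℝ := Matrix.of fun i j =>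
  if i = j ∧ i.val ≤ 2 * t then (2 : ℝ)
  else if (i.val = j.val + 1 ∨ j.val = i.val + 1) ∧ i.val ≤ 2 * t ∧ j.val ≠ 2 * t + 1
    then (-1 : ℝ) else 0

theorem nesterovMatrix_isSymm (d t : ℕ) : (nesterovMatrix d t).IsSymm := by
  ext i j
  simp only [nesterovMatrix, Matrix.transpose_apply, Matrix.of_apply, Fin.ext_iff]
  split_ifs <;> first | rfl | omega

/-- `nesterovMatrix` acts as the negative second difference on the first `2t+1` coordinates. -/
theorem nesterovMatrix_mulVec_apply {d t : ℕ} (hdt : 2 * t + 1 ≤ d) (x : Fin d → ℝ) (U : ℕ → ℝ)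
    (hU₀ : U 0 = 0) (hU_end : U (2 * t + 2) = 0)
    (hU : ∀ i : Fin d, i.val ≤ 2 * t → U (i + 1) = x i) (i : Fin d) :
    (nesterovMatrix d t).mulVec x i =
      if i.val ≤ 2 * t then 2 * U (i + 1) - U i - U (i + 2) else 0 := by
  by_cases hi : i.val ≤ 2 * t
  · have hrow : ∑ j, nesterovMatrix d t i j * x j =
        ∑ k ∈ Finset.range d, ((if k = i.val then 2 * U (k + 1) else 0)
          + (if k + 1 = i.val then -U (k + 1) else 0)
          + (if k = i.val + 1 then -U (k + 1) else 0)) := by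
      rw [← Fin.sum_univ_eq_sum_range]
      refine Finset.sum_congr rfl fun j _ => ?_
      by_cases hj : j.val ≤ 2 * t
      · simp only [nesterovMatrix, Matrix.of_apply, hU j hj, Fin.ext_iff]
        split_ifs <;> first | omega | ring
      · have hU' : j.val = i.val + 1 → U (j.val + 1) = 0 := fun h => by
          rw [← hU_end]; congr 1; omega
        simp only [nesterovMatrix, Matrix.of_apply, Fin.ext_iff]
        split_ifs <;> first | omega | simp_all
    have hpred : ∑ k ∈ Finset.range d, (if k + 1 = i.val then -U (k + 1) else 0) = -U i := by
      rcases Nat.eq_zero_or_pos i.val with h | h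
      · simp [h, hU₀]
      · obtain ⟨m, hm⟩ : ∃ m, i.val = m + 1 := ⟨i.val - 1, by omega⟩
        have hmd : m < d := by omega
        simp [hm, hmd]
    have hsucc : ∑ k ∈ Finset.range d, (if k = i.val + 1 then -U (k + 1) else 0)
        = -U (i + 2) := by
      rw [Finset.sum_ite_eq']
      split_ifs with h
      · rfl
      · have : i.val = 2 * t := by simp at h; omega
        rw [this, hU_end, neg_zero]
    rw [if_pos hi, Matrix.mulVec, dotProduct, hrow, Finset.sum_add_distrib, Finset.sum_add_distrib, hpred, hsucc,
      Finset.sum_ite_eq', if_pos (Finset.mem_range.2 i.isLt)]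
    ring
  · rw [if_neg hi, Matrix.mulVec, dotProduct]
    refine Finset.sum_eq_zero fun j _ => ?_
    simp [nesterovMatrix, hi]

/-- Summation by parts for the second difference. -/
theorem sum_mul_second_difference (U : ℕ → ℝ) (hU₀ : U 0 = 0) (m : ℕ) :
    ∑ i ∈ Finset.range m, U (i + 1) * (2 * U (i + 1) - U i - U (i + 2)) =
      ∑ i ∈ Finset.range m, (U (i + 1) - U i) ^ 2 + U m * (U m - U (m + 1)) := by
  induction m with
  | zero => simp [hU₀]
  | succ m ih => rw [Finset.sum_range_succ, Finset.sum_range_succ, ih]; ring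

theorem sum_sq_difference_ge (U : ℕ → ℝ) (hU₀ : U 0 = 0) (m : ℕ) (hm : 0 < m)
    (hU_end : U (m + 1) = 0) :
    (m + 1) / m * U 1 ^ 2 ≤ ∑ i ∈ Finset.range (m + 1), (U (i + 1) - U i) ^ 2 := by
  have hm' : (0 : ℝ) < m := by exact_mod_cast hm
  have hcs := sq_sum_le_card_mul_sum_sq (s := Finset.range m)
    (f := fun i => U (i + 1 + 1) - U (i + 1))
  rw [Finset.sum_range_sub (fun i => U (i + 1)), hU_end, Finset.card_range] at hcs
  rw [Finset.sum_range_succ', hU₀, div_mul_eq_mul_div, div_le_iff₀ hm']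
  simp only [zero_add] at hcs ⊢
  nlinarith

theorem nesterov_quadratic_lower_bound {d t : ℕ} (hdt : 2 * t + 1 ≤ d) (x : Fin d → ℝ) :
    -((2 * t + 1 : ℝ) / (2 * t + 2)) ≤
      x ⬝ᵥ (nesterovMatrix d t).mulVec x - 2 * x ⟨0, by omega⟩ := by
  let U : ℕ → ℝ := fun k => if h : 0 < k ∧ k ≤ 2 * t + 1 then x ⟨k - 1, by omega⟩ else 0
  have hU₀ : U 0 = 0 := by simp [U]
  have hU_end : U (2 * t + 2) = 0 := by simp [U]
  have hU : ∀ i : Fin d, i.val ≤ 2 * t → U (i + 1) = x i := fun i hi => by simp [U, hi]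
  have hquad : x ⬝ᵥ (nesterovMatrix d t).mulVec x
      = ∑ i ∈ Finset.range (2 * t + 1 + 1), (U (i + 1) - U i) ^ 2 := by
    have hsum : ∑ i, x i * (nesterovMatrix d t).mulVec x i =
        ∑ k ∈ Finset.range d, if k < 2 * t + 1 then
          U (k + 1) * (2 * U (k + 1) - U k - U (k + 2)) else 0 := by
      rw [← Fin.sum_univ_eq_sum_range]
      refine Finset.sum_congr rfl fun i _ => ?_
      rw [nesterovMatrix_mulVec_apply hdt x U hU₀ hU_end hU]
      by_cases hi : i.val ≤ 2 * t
      · simp only [hi, Nat.lt_succ_of_le hi, if_true, hU i hi]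
      · simp [hi]
    rw [dotProduct, hsum,
      ← Finset.sum_filter,
      show (Finset.range d).filter (· < 2 * t + 1) = Finset.range (2 * t + 1) by
        ext k; simp; omega,
      sum_mul_second_difference U hU₀, Finset.sum_range_succ _ (2 * t + 1), hU_end]
    ring
  have hge := sum_sq_difference_ge U hU₀ (2 * t + 1) (by omega) hU_end
  have hx₀ : U 1 = x ⟨0, by omega⟩ := hU ⟨0, by omega⟩ (Nat.zero_le _)
  rw [hquad, ← hx₀]
  push_cast at hge
  set q : ℝ := 2 * t + 1 with hq
  have hq_pos : 0 < q := by positivity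
  have hsq : (q + 1) / q * U 1 ^ 2 - 2 * U 1 + q / (q + 1)
      = (q + 1) / q * (U 1 - q / (q + 1)) ^ 2 := by field_simp; ring
  have hnonneg : 0 ≤ (q + 1) / q * (U 1 - q / (q + 1)) ^ 2 := by positivity
  rw [show (2 * t + 2 : ℝ) = q + 1 by rw [hq]; ring]
  linarith

theorem sum_range_succ_sq (t : ℕ) :
    ∑ k ∈ Finset.range t, ((k : ℝ) + 1) ^ 2 = (t : ℝ) * (t + 1) * (2 * t + 1) / 6 := by
  induction t with
  | zero => simp
  | succ t ih => rw [Finset.sum_range_succ, ih]; push_cast; ring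

/-- The linear ramp `(1, 2, …, t, 0, …, 0)`. -/
def rampVector (d t : ℕ) : Fin d → ℝ := fun i => if i.val < t then (i.val : ℝ) + 1 else 0

theorem sum_rampVector_sq {d t : ℕ} (htd : t ≤ d) :
    ∑ i, rampVector d t i ^ 2 = (t : ℝ) * (t + 1) * (2 * t + 1) / 6 := by
  have hsum : ∑ i, rampVector d t i ^ 2 =
      ∑ k ∈ Finset.range d, if k < t then ((k : ℝ) + 1) ^ 2 else 0 := by
    rw [← Fin.sum_univ_eq_sum_range]
    refine Finset.sum_congr rfl fun i _ => ?_
    simp only [rampVector]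
    split_ifs <;> simp
  rw [hsum, ← Finset.sum_filter,
    show (Finset.range d).filter (· < t) = Finset.range t by ext k; simp; omega,
    sum_range_succ_sq]

theorem dotProduct_nesterovMatrix_mulVec_rampVector {d t : ℕ} (hdt : 2 * t + 1 ≤ d)
    (x : Fin d → ℝ) (hx : ∀ j : Fin d, t ≤ j.val + 1 → x j = 0) :
    x ⬝ᵥ (nesterovMatrix d t).mulVec (rampVector d t) = 0 := by
  refine Finset.sum_eq_zero fun i _ => ?_
  by_cases hi : t ≤ i.val + 1
  · rw [hx i hi, zero_mul]
  · rw [nesterovMatrix_mulVec_apply hdt (rampVector d t) (fun k => if k ≤ t then (k : ℝ) else 0)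
      (by simp) (if_neg (by omega))
      (fun j _ => by simp [rampVector])]
    rw [if_pos (by omega), if_pos (by omega), if_pos (by omega), if_pos (by omega)]
    push_cast
    ring


/-- Deterministic lower bound: for iterates `w^{(s)}` of a first-order black-box
procedure on the Nesterov function, with `w^{(s)}` in the span of `e₁, …, e_{s−1}`,
the minimum squared gradient norm over `1 ≤ s ≤ t` is at least
`6L(F(w^{(1)}) − F*)/(t(2t+1)²)`. -/
theorem nesterov_lower_bound {d t : ℕ} (ht : 1 ≤ t) (hdt : 2 * t + 1 ≤ d)
    (L : ℝ) (hL : 0 < L)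
    (A : Matrix (Fin d) (Fin d) ℝ)
    (hA : ∀ i j : Fin d, A i j =
      if i = j ∧ i.val ≤ 2 * t then (2 : ℝ)
      else if (i.val = j.val + 1 ∨ j.val = i.val + 1) ∧ i.val ≤ 2 * t ∧ j.val ≠ 2 * t + 1
        then (-1 : ℝ) else 0)
    (F : EuclideanSpace ℝ (Fin d) → ℝ)
    (hF : ∀ w : EuclideanSpace ℝ (Fin d),
      F w = L / 8 * ((∑ i, ∑ j, w i * A i j * w j) - 2 * w ⟨0, by omega⟩))
    (Fstar : ℝ) (hFstar : IsGLB (Set.range F) Fstar)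
    (w : ℕ → EuclideanSpace ℝ (Fin d))
    (hspan : ∀ s : ℕ, 1 ≤ s → s ≤ t → ∀ j : Fin d, s ≤ j.val + 1 → w s j = 0) :
    ∀ s : ℕ, 1 ≤ s → s ≤ t →
      6 * L * (F (w 1) - Fstar) / ((t : ℝ) * (2 * (t : ℝ) + 1) ^ 2) ≤
        ‖gradient F (w s)‖ ^ 2 := by
  intro s hs hst
  obtain rfl : A = nesterovMatrix d t := by
    ext i j
    rw [hA]
    rfl
  have hFdot : ∀ x : EuclideanSpace ℝ (Fin d), F x = L / 8 *
      ((x : Fin d → ℝ) ⬝ᵥ (nesterovMatrix d t).mulVec x - 2 * x ⟨0, by omega⟩) := by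
    intro x
    simp only [hF, dotProduct, Matrix.mulVec, Finset.mul_sum, mul_assoc]
  have hw₁ : F (w 1) = 0 := by
    have : ∀ j, w 1 j = 0 := fun j => hspan 1 le_rfl ht j (by omega)
    simp [hF, this]
  have hFstar_ge : -(L / 8 * ((2 * t + 1) / (2 * t + 2))) ≤ Fstar := by
    refine hFstar.2 ?_
    rintro _ ⟨x, rfl⟩
    rw [hFdot, ← mul_neg]
    exact mul_le_mul_of_nonneg_left (nesterov_quadratic_lower_bound hdt _) (by positivity)
  have hdiff : Differentiable ℝ F := by
    rw [funext hF]
    fun_prop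
  let y : EuclideanSpace ℝ (Fin d) := WithLp.toLp 2 (rampVector d t)
  have hinner : inner ℝ (gradient F (w s)) y = -(L / 4) := by
    have hortho := dotProduct_nesterovMatrix_mulVec_rampVector hdt (w s)
      fun j hj => hspan s hs hst j (hst.trans hj)
    have hortho' : rampVector d t ⬝ᵥ (nesterovMatrix d t).mulVec (w s) = 0 := by
      rw [Matrix.dotProduct_mulVec, ← Matrix.mulVec_transpose, (nesterovMatrix_isSymm d t).eq,
        dotProduct_comm, hortho]
    have hy₀ : rampVector d t ⟨0, by omega⟩ = 1 := by
      simp [rampVector, Nat.lt_of_succ_le ht]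
    have hline : HasLineDerivAt ℝ F (-(L / 4)) (w s) y := by
      have hexpand : (fun τ : ℝ => F (w s + τ • y)) = fun τ : ℝ => F (w s) - L / 4 * τ
          + L / 8 * (rampVector d t ⬝ᵥ (nesterovMatrix d t).mulVec (rampVector d t)) * τ ^ 2 := by
        funext τ
        simp only [hFdot, y, WithLp.ofLp_add, WithLp.ofLp_smul, Matrix.mulVec_add,
          Matrix.mulVec_smul, dotProduct_add, add_dotProduct, smul_dotProduct, dotProduct_smul,
          hortho, hortho', Pi.add_apply, Pi.smul_apply, hy₀, smul_eq_mul]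
        ring
      rw [HasLineDerivAt, hexpand]
      have h₁ := ((hasDerivAt_id (0 : ℝ)).const_mul (L / 4)).const_sub (F (w s))
      have h₂ := ((hasDerivAt_id (0 : ℝ)).pow 2).const_mul
        (L / 8 * (rampVector d t ⬝ᵥ (nesterovMatrix d t).mulVec (rampVector d t)))
      have h := h₁.fun_add h₂
      simpa using h
    rw [inner_gradient_left, ← (hdiff (w s)).lineDeriv_eq_fderiv, hline.lineDeriv]
  have hnorm_y : ‖y‖ ^ 2 = t * (t + 1) * (2 * t + 1) / 6 := by
    rw [EuclideanSpace.real_norm_sq_eq]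
    exact sum_rampVector_sq (by omega)
  have hcs : (L / 4) ^ 2 ≤ ‖gradient F (w s)‖ ^ 2 * ‖y‖ ^ 2 := by
    have h := abs_real_inner_le_norm (gradient F (w s)) y
    rw [hinner, abs_neg] at h
    rw [← mul_pow, ← sq_abs (L / 4)]
    gcongr
  have ht_pos : (0 : ℝ) < t := by exact_mod_cast ht
  calc 6 * L * (F (w 1) - Fstar) / ((t : ℝ) * (2 * (t : ℝ) + 1) ^ 2)
      ≤ 6 * L * (L / 8 * ((2 * t + 1) / (2 * t + 2))) / ((t : ℝ) * (2 * (t : ℝ) + 1) ^ 2) := by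
        gcongr
        linarith
    _ = (L / 4) ^ 2 / (t * (t + 1) * (2 * t + 1) / 6) := by
        field_simp
        ring
    _ ≤ ‖gradient F (w s)‖ ^ 2 := by
        rw [div_le_iff₀ (by positivity), ← hnorm_y]
        exact hcs
end

section
/- For every w ∈ ℝ^d with w_j = 0 for all j ≥ t, one has ‖∇F(w)‖² ≥ 3L²/(8t(t+1)(2t+1)); moreover this bound is attained: the vector w^{t,*} whose i-th coordinate equals (2t³ − 3(i−1)t² − (3i−1)t + i³ − i)/(t(t+1)(2t+1)) for 1 ≤ i ≤ t−1 and 0 otherwise satisfies ‖∇F(w^{t,*})‖² = 3L²/(8t(t+1)(2t+1)). -/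
open Finset

/-- The gradient of the quadratic `c (xᵀAx - 2 xₖ)` with `A` symmetric. -/
theorem hasGradientAt_quadratic_sub_coord {ι : Type*} [Fintype ι] [DecidableEq ι]
    (A : Matrix ι ι ℝ) (hA : ∀ i j, A i j = A j i) (c : ℝ) (k : ι) (w : EuclideanSpace ℝ ι) :
    HasGradientAt
      (fun x : EuclideanSpace ℝ ι => c * ((∑ i, ∑ j, x i * A i j * x j) - 2 * x k))
      (WithLp.toLp 2 fun i => 2 * c * ((∑ j, A i j * w j) - if i = k then 1 else 0)) w := by
  have hp : ∀ i, HasFDerivAt (fun x : EuclideanSpace ℝ ι => x i)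
      (EuclideanSpace.proj i : EuclideanSpace ℝ ι →L[ℝ] ℝ) w := fun i =>
    (EuclideanSpace.proj i : EuclideanSpace ℝ ι →L[ℝ] ℝ).hasFDerivAt
  have hq := ((HasFDerivAt.fun_sum (u := univ) fun i _ => HasFDerivAt.fun_sum (u := univ)
    fun j _ => ((hp i).mul_const (A i j)).mul (hp j)).sub ((hp k).const_mul 2)).const_mul c
  rw [hasGradientAt_iff_hasFDerivAt]
  refine hq.congr_fderiv ?_
  ext v
  have hswap : ∑ i, ∑ j, v i * A i j * w j = ∑ i, ∑ j, w i * A i j * v j := by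
    rw [sum_comm]
    refine sum_congr rfl fun i _ => sum_congr rfl fun j _ => ?_
    rw [hA j i]
    ring
  have hdual : ∑ i, (2 * c * ((∑ j, A i j * w j) - if i = k then 1 else 0)) * v i
      = 2 * c * ((∑ i, ∑ j, v i * A i j * w j) - v k) := by
    have hk : v k = ∑ i, (if i = k then 1 else 0) * v i := by simp
    rw [hk, ← sum_sub_distrib, mul_sum]
    refine sum_congr rfl fun i _ => ?_
    simp only [mul_assoc, ← mul_sum]
    ring
  have hderiv : ∑ i, ∑ j, (w i * A i j * v j + w j * (A i j * v i))
      = 2 * ∑ i, ∑ j, v i * A i j * w j := by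
    simp only [sum_add_distrib]
    rw [← hswap, two_mul]
    congr 1
    refine sum_congr rfl fun i _ => sum_congr rfl fun j _ => ?_
    ring
  simp only [InnerProductSpace.toDual_apply_apply, PiLp.inner_apply, RCLike.inner_apply,
    conj_trivial, mul_comm (v _)]
  rw [hdual]
  simp [hderiv]
  ring

theorem sum_succ_sq (t : ℕ) :
    ∑ i ∈ range t, ((i : ℝ) + 1) ^ 2 = (t : ℝ) * (t + 1) * (2 * t + 1) / 6 := by
  induction t with
  | zero => simp
  | succ t ih =>
    rw [sum_range_succ, ih]
    push_cast
    ring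

/-- The vector `(1, 2, …, t, 0, …)`, indexed from `1`. -/
def truncId (t n : ℕ) : ℝ := if n ≤ t then n else 0

theorem sum_truncId_sq {d t : ℕ} (h : t ≤ d) :
    ∑ i : Fin d, truncId t (i.val + 1) ^ 2 = t * (t + 1) * (2 * t + 1) / 6 := by
  rw [Fin.sum_univ_eq_sum_range (fun i => truncId t (i + 1) ^ 2), ← sum_succ_sq]
  symm
  refine sum_subset_zero_on_sdiff (range_subset_range.2 h) (fun i hi => ?_) fun i hi => ?_
  · have : ¬ i + 1 ≤ t := by simp at hi; omega
    simp [truncId, this]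
  · have : i + 1 ≤ t := by simp at hi; omega
    simp [truncId, this]

/-- The minimiser `w^{t,*}`, indexed from `1` and extended by `0` at index `0`. -/
noncomputable def minimizerCoord (t n : ℕ) : ℝ :=
  if n = 0 then 0 else if n + 1 ≤ t then
    (2 * (t : ℝ) ^ 3 - 3 * ((n : ℝ) - 1) * (t : ℝ) ^ 2 - (3 * (n : ℝ) - 1) * (t : ℝ)
      + (n : ℝ) ^ 3 - (n : ℝ)) / ((t : ℝ) * ((t : ℝ) + 1) * (2 * (t : ℝ) + 1))
  else 0

theorem minimizerCoord_of_le {t n : ℕ} (ht : 1 ≤ t) (hn : n ≠ 0) (hnt : n ≤ t + 1) :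
    minimizerCoord t n =
      (2 * (t : ℝ) ^ 3 - 3 * ((n : ℝ) - 1) * (t : ℝ) ^ 2 - (3 * (n : ℝ) - 1) * (t : ℝ)
        + (n : ℝ) ^ 3 - (n : ℝ)) / ((t : ℝ) * ((t : ℝ) + 1) * (2 * (t : ℝ) + 1)) := by
  rw [minimizerCoord, if_neg hn]
  split_ifs with h
  · rfl
  · obtain rfl | rfl : n = t ∨ n = t + 1 := by omega
    · symm
      rw [div_eq_zero_iff]
      left
      ring
    · symm
      rw [div_eq_zero_iff]
      left
      push_cast
      ring

theorem minimizerCoord_second_diff {t i : ℕ} (ht : 1 ≤ t) (hi : i < t) :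
    2 * minimizerCoord t (i + 1) - minimizerCoord t (i + 2) - minimizerCoord t i
      - (if i = 0 then 1 else 0)
      = -(6 / ((t : ℝ) * ((t : ℝ) + 1) * (2 * (t : ℝ) + 1))) * truncId t (i + 1) := by
  have htpos : (0 : ℝ) < t := by exact_mod_cast ht
  rw [minimizerCoord_of_le ht (by omega) (by omega : i + 1 ≤ t + 1),
    minimizerCoord_of_le ht (by omega) (by omega : i + 2 ≤ t + 1), truncId,
    if_pos (show i + 1 ≤ t by omega)]
  obtain rfl | h0 := Nat.eq_zero_or_pos i
  · simp only [minimizerCoord]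
    push_cast
    field_simp
    ring
  · rw [minimizerCoord_of_le ht (by omega) (by omega : i ≤ t + 1), if_neg (show ¬ i = 0 by omega)]
    push_cast
    field_simp
    ring

/-- The matrix `A` acts as the discrete Laplacian with zero boundary value at index `0`. -/
theorem sum_nesterov_row {d t : ℕ} (hdt : 2 * t + 1 ≤ d) (A : Matrix (Fin d) (Fin d) ℝ)
    (hA : ∀ i j : Fin d, A i j =
      if i = j ∧ i.val ≤ 2 * t then (2 : ℝ)
      else if (i.val = j.val + 1 ∨ j.val = i.val + 1) ∧ i.val ≤ 2 * t ∧ j.val ≠ 2 * t + 1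
        then (-1 : ℝ) else 0)
    (x : ℕ → ℝ) (hx : x 0 = 0) (i : Fin d) (hi : i.val < 2 * t) :
    ∑ j : Fin d, A i j * x (j.val + 1) = 2 * x (i.val + 1) - x (i.val + 2) - x i.val := by
  have hterm : ∀ j : Fin d, A i j * x (j.val + 1) =
      (if j.val = i.val then 2 * x (i.val + 1) else 0)
        + (if j.val = i.val + 1 then -x (i.val + 2) else 0)
        + (if j.val = i.val - 1 then -x i.val else 0) := by
    intro j
    simp only [hA, Fin.ext_iff]
    rcases Nat.eq_zero_or_pos i.val with h0 | h0
    · simp only [h0, hx]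
      grind
    · grind
  rw [sum_congr rfl fun j _ => hterm j, Fin.sum_univ_eq_sum_range (fun m =>
    (if m = i.val then 2 * x (i.val + 1) else 0)
      + (if m = i.val + 1 then -x (i.val + 2) else 0)
      + (if m = i.val - 1 then -x i.val else 0)) d]
  simp only [sum_add_distrib, sum_ite_eq', mem_range]
  rw [if_pos i.isLt, if_pos (by omega), if_pos (by omega)]
  ring


/-- Lower bound on the squared gradient norm of the Nesterov function over vectors
supported on the first `t−1` coordinates, attained at `w^{t,*}`. -/
theorem nesterov_min_gradient_norm {d t : ℕ} (ht : 1 ≤ t) (hdt : 2 * t + 1 ≤ d)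
    (L : ℝ) (hL : 0 < L)
    (A : Matrix (Fin d) (Fin d) ℝ)
    (hA : ∀ i j : Fin d, A i j =
      if i = j ∧ i.val ≤ 2 * t then (2 : ℝ)
      else if (i.val = j.val + 1 ∨ j.val = i.val + 1) ∧ i.val ≤ 2 * t ∧ j.val ≠ 2 * t + 1
        then (-1 : ℝ) else 0)
    (F : EuclideanSpace ℝ (Fin d) → ℝ)
    (hF : ∀ w : EuclideanSpace ℝ (Fin d),
      F w = L / 8 * ((∑ i, ∑ j, w i * A i j * w j) - 2 * w ⟨0, by omega⟩))
    (wstar : EuclideanSpace ℝ (Fin d))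
    (hwstar : ∀ i : Fin d, wstar i =
      if i.val + 2 ≤ t then
        (2 * (t : ℝ) ^ 3 - 3 * (((i.val : ℝ) + 1) - 1) * (t : ℝ) ^ 2
            - (3 * ((i.val : ℝ) + 1) - 1) * (t : ℝ) + ((i.val : ℝ) + 1) ^ 3 - ((i.val : ℝ) + 1))
          / ((t : ℝ) * ((t : ℝ) + 1) * (2 * (t : ℝ) + 1))
      else 0) :
    (∀ w : EuclideanSpace ℝ (Fin d), (∀ j : Fin d, t ≤ j.val + 1 → w j = 0) →
      3 * L ^ 2 / (8 * (t : ℝ) * ((t : ℝ) + 1) * (2 * (t : ℝ) + 1)) ≤ ‖gradient F w‖ ^ 2) ∧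
    ‖gradient F wstar‖ ^ 2 = 3 * L ^ 2 / (8 * (t : ℝ) * ((t : ℝ) + 1) * (2 * (t : ℝ) + 1)) := by
  set D : ℝ := (t : ℝ) * ((t : ℝ) + 1) * (2 * (t : ℝ) + 1) with hD
  have htpos : (0 : ℝ) < t := by exact_mod_cast ht
  have hDpos : 0 < D := by positivity
  have hsymm : ∀ i j, A i j = A j i := by
    intro i j
    simp only [hA, Fin.ext_iff]
    grind
  have hnorm : ∀ w, ‖gradient F w‖ ^ 2 = L ^ 2 / 16 *
      ∑ i, ((∑ j, A i j * w j) - if i = ⟨0, by omega⟩ then 1 else 0) ^ 2 := by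
    intro w
    have hg := hasGradientAt_quadratic_sub_coord A hsymm (L / 8) ⟨0, by omega⟩ w
    rw [← funext hF] at hg
    rw [hg.gradient, EuclideanSpace.real_norm_sq_eq, mul_sum]
    refine sum_congr rfl fun i _ => ?_
    ring
  have hbound : 3 * L ^ 2 / (8 * (t : ℝ) * ((t : ℝ) + 1) * (2 * (t : ℝ) + 1))
      = L ^ 2 / 16 * (6 / D) := by
    rw [hD]
    field_simp
    norm_num
  have hvsq := sum_truncId_sq (d := d) (t := t) (by omega)
  rw [← hD] at hvsq
  rw [hbound]
  constructor
  · intro w hw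
    rw [hnorm]
    refine mul_le_mul_of_nonneg_left ?_ (by positivity)
    have hcol : ∑ i : Fin d, truncId t (i.val + 1) * ∑ j, A i j * w j = 0 := by
      simp only [mul_sum]
      rw [sum_comm]
      refine sum_eq_zero fun j _ => ?_
      by_cases hj : t ≤ j.val + 1
      · simp [hw j hj]
      · have hrow := sum_nesterov_row hdt A hA (truncId t) (by simp [truncId]) j (by omega)
        have hzero : ∑ i, A j i * truncId t (i.val + 1) = 0 := by
          rw [hrow]
          simp only [truncId]
          rw [if_pos (by omega), if_pos (by omega), if_pos (by omega)]
          push_cast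
          ring
        rw [← zero_mul (w j), ← hzero, sum_mul]
        refine sum_congr rfl fun i _ => ?_
        rw [hsymm i j]
        ring
    have hinner : ∑ i : Fin d, truncId t (i.val + 1) *
        ((∑ j, A i j * w j) - if i = ⟨0, by omega⟩ then 1 else 0) = -1 := by
      simp only [mul_sub, sum_sub_distrib, hcol]
      simp [truncId, Nat.one_le_iff_ne_zero.1 ht]
    have hcs := sum_mul_sq_le_sq_mul_sq univ (fun i : Fin d => truncId t (i.val + 1))
      (fun i => (∑ j, A i j * w j) - if i = ⟨0, by omega⟩ then 1 else 0)
    rw [hinner, hvsq] at hcs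
    rw [div_le_iff₀ hDpos]
    linarith
  · rw [hnorm]
    congr 1
    have hw : ∀ j : Fin d, wstar j = minimizerCoord t (j.val + 1) := by
      intro j
      rw [hwstar, minimizerCoord, if_neg (Nat.succ_ne_zero _)]
      push_cast
      rfl
    have hres : ∀ i : Fin d, (∑ j, A i j * wstar j) - (if i = ⟨0, by omega⟩ then 1 else 0)
        = -(6 / D) * truncId t (i.val + 1) := by
      intro i
      by_cases hi : i.val < t
      · simp only [hw, Fin.ext_iff]
        rw [sum_nesterov_row hdt A hA (minimizerCoord t) (by simp [minimizerCoord]) i (by omega),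
          minimizerCoord_second_diff ht hi]
      · rw [truncId, if_neg (show ¬ i.val + 1 ≤ t by omega),
            if_neg (show ¬ i = ⟨0, by omega⟩ by simp only [Fin.ext_iff]; omega),
          sum_eq_zero fun j _ => ?_]
        · simp
        · rw [hwstar, hA]
          simp only [Fin.ext_iff]
          grind
    simp only [hres, mul_pow, ← mul_sum, hvsq]
    field_simp
end

section
/- Let w^{t,*} ∈ ℝ^d be the vector whose i-th coordinate equals (2t³ − 3(i−1)t² − (3i−1)t + i³ − i)/(t(t+1)(2t+1)) for 1 ≤ i ≤ t−1 and 0 otherwise. Then the i-th component of the gradient of F at w^{t,*} equals −3Li/(2t(t+1)(2t+1)) for 1 ≤ i ≤ t, and equals 0 for t < i ≤ d. -/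
/-- Coordinates of the gradient of a quadratic function with symmetric matrix and linear part
a multiple of a coordinate. -/
theorem gradient_quadratic_sub_coord_apply {ι : Type*} [Fintype ι] [DecidableEq ι]
    {A : Matrix ι ι ℝ} (hA : A.IsSymm) (c : ℝ) (k : ι) (x : EuclideanSpace ℝ ι) (i : ι) :
    gradient (fun w : EuclideanSpace ℝ ι =>
        c * ((∑ i, ∑ j, w i * A i j * w j) - 2 * w k)) x i =
      2 * c * ((∑ j, A i j * x j) - if i = k then 1 else 0) := by
  have hproj (j : ι) : HasFDerivAt (fun w : EuclideanSpace ℝ ι => w j)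
      (EuclideanSpace.proj j : EuclideanSpace ℝ ι →L[ℝ] ℝ) x :=
    (EuclideanSpace.proj j : EuclideanSpace ℝ ι →L[ℝ] ℝ).hasFDerivAt
  have hF := ((HasFDerivAt.fun_sum (u := Finset.univ) fun i _ =>
    HasFDerivAt.fun_sum (u := Finset.univ) fun j _ =>
      ((hproj i).mul_const (A i j)).mul (hproj j)).sub ((hproj k).const_mul 2)).const_mul c
  have hcoord (v : EuclideanSpace ℝ ι) : v i = inner ℝ v (EuclideanSpace.single i 1) := by
    simp [EuclideanSpace.inner_single_right]
  rw [hcoord, gradient, InnerProductSpace.toDual_symm_apply]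
  erw [hF.fderiv]
  have hsymm (j : ι) : A j i = A i j := hA.apply i j
  simp [Finset.sum_add_distrib, hsymm, eq_comm (a := k)]
  simp only [mul_comm (x _)]
  split_ifs <;> ring

/-- The matrix of second differences truncated after row `m`, applied to a sequence vanishing
beyond index `m`, yields minus the second difference, up to the boundary term at `0`. -/
theorem sum_tridiagonal_mul {d m : ℕ} (hmd : m < d) (u : ℕ → ℝ)
    (hu : ∀ n, m < n → u n = 0) (A : Matrix (Fin d) (Fin d) ℝ)
    (hA : ∀ i j : Fin d, A i j =
      if i = j ∧ i.val ≤ m then (2 : ℝ)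
      else if (i.val = j.val + 1 ∨ j.val = i.val + 1) ∧ i.val ≤ m ∧ j.val ≠ m + 1
        then (-1 : ℝ) else 0) (i : Fin d) (hi : i.val ≤ m) :
    ∑ j, A i j * u (j.val + 1) =
      2 * u (i.val + 1) - (if i.val = 0 then 0 else u i.val) - u (i.val + 2) := by
  have hterm (j : Fin d) : A i j * u (j.val + 1) =
      (if j.val = i.val then 2 * u (i.val + 1) else 0)
        - (if j.val + 1 = i.val then u i.val else 0)
        - (if j.val = i.val + 1 then u (i.val + 2) else 0) := by
    rw [hA]
    rcases lt_or_ge m (j.val + 1) with h | h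
    · rw [hu _ h, mul_zero]
      split_ifs <;> first | omega | (simp; done) | (rw [hu]; ring; omega)
    · simp only [Fin.ext_iff]
      split_ifs <;> first | omega | grind
  have hlast : (if i.val + 1 < d then u (i.val + 2) else 0) = u (i.val + 2) := by
    split_ifs
    · rfl
    · rw [hu]; omega
  simp_rw [hterm]
  rw [Fin.sum_univ_eq_sum_range (fun j => (if j = i.val then 2 * u (i.val + 1) else 0)
        - (if j + 1 = i.val then u i.val else 0)
        - (if j = i.val + 1 then u (i.val + 2) else 0)) d]
  simp only [Finset.sum_sub_distrib, Finset.sum_ite_eq', Finset.mem_range, i.isLt, if_true, hlast]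
  congr 2
  rcases i with ⟨_ | n, hn⟩
  · simp
  · simp [Finset.sum_ite_eq', Nat.lt_of_succ_lt hn]

/-- Gradient components of the Nesterov function at the minimizer `w^{t,*}` of the
squared gradient norm over the span of the first `t−1` coordinates. -/
theorem nesterov_gradient_at_wstar {d t : ℕ} (ht : 1 ≤ t) (hdt : 2 * t + 1 ≤ d)
    (L : ℝ) (hL : 0 < L)
    (A : Matrix (Fin d) (Fin d) ℝ)
    (hA : ∀ i j : Fin d, A i j =
      if i = j ∧ i.val ≤ 2 * t then (2 : ℝ)
      else if (i.val = j.val + 1 ∨ j.val = i.val + 1) ∧ i.val ≤ 2 * t ∧ j.val ≠ 2 * t + 1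
        then (-1 : ℝ) else 0)
    (F : EuclideanSpace ℝ (Fin d) → ℝ)
    (hF : ∀ w : EuclideanSpace ℝ (Fin d),
      F w = L / 8 * ((∑ i, ∑ j, w i * A i j * w j) - 2 * w ⟨0, by omega⟩))
    (wstar : EuclideanSpace ℝ (Fin d))
    (hwstar : ∀ i : Fin d, wstar i =
      if i.val + 2 ≤ t then
        (2 * (t : ℝ) ^ 3 - 3 * (((i.val : ℝ) + 1) - 1) * (t : ℝ) ^ 2
            - (3 * ((i.val : ℝ) + 1) - 1) * (t : ℝ) + ((i.val : ℝ) + 1) ^ 3 - ((i.val : ℝ) + 1))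
          / ((t : ℝ) * ((t : ℝ) + 1) * (2 * (t : ℝ) + 1))
      else 0) :
    ∀ i : Fin d,
      (i.val + 1 ≤ t →
        gradient F wstar i =
          -(3 * L * ((i.val : ℝ) + 1)) / (2 * (t : ℝ) * ((t : ℝ) + 1) * (2 * (t : ℝ) + 1))) ∧
      (t < i.val + 1 → gradient F wstar i = 0) := by
  obtain rfl : F = _ := funext hF
  have hsymm : A.IsSymm := Matrix.IsSymm.ext fun i j => by
    simp only [hA, Fin.ext_iff]
    split_ifs <;> first | rfl | omega
  have ht' : (1 : ℝ) ≤ t := by exact_mod_cast ht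
  set p : ℝ → ℝ := fun x =>
    (2 * (t : ℝ) ^ 3 - 3 * (x - 1) * (t : ℝ) ^ 2 - (3 * x - 1) * (t : ℝ) + x ^ 3 - x)
      / ((t : ℝ) * ((t : ℝ) + 1) * (2 * (t : ℝ) + 1)) with hp
  have hp_zero : p 0 = 1 := by simp only [hp]; field_simp; ring
  have hp_t : p t = 0 := by simp only [hp]; field_simp; ring
  have hp_succ : p (t + 1) = 0 := by simp only [hp]; field_simp; ring
  set u : ℕ → ℝ := fun n => if n ≤ t + 1 then p n else 0
  have hu_eq (n : ℕ) (hn : n ≤ t + 1) : u n = p n := if_pos hn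
  have hu_zero (n : ℕ) (hn : t ≤ n) : u n = 0 := by
    rcases lt_or_ge (t + 1) n with h | h
    · exact if_neg (by omega)
    · rw [hu_eq n h]
      obtain rfl | rfl : n = t ∨ n = t + 1 := by omega
      · exact hp_t
      · exact_mod_cast hp_succ
  have hw (j : Fin d) : wstar j = u (j.val + 1) := by
    rw [hwstar]
    split_ifs with h
    · rw [hu_eq _ (by omega)]
      simp [hp]
    · rw [hu_zero _ (by omega)]
  have hgrad (i : Fin d) : gradient (fun w : EuclideanSpace ℝ (Fin d) =>
      L / 8 * ((∑ i, ∑ j, w i * A i j * w j) - 2 * w ⟨0, by omega⟩)) wstar i =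
      L / 4 * (2 * u (i.val + 1) - u i.val - u (i.val + 2)) := by
    rw [gradient_quadratic_sub_coord_apply hsymm]
    simp_rw [hw]
    rcases le_or_gt i.val (2 * t) with hi | hi
    · rw [sum_tridiagonal_mul (by omega) u (fun n hn => hu_zero n (by omega)) A hA i hi]
      by_cases h : i.val = 0
      · have hu0 : u 0 = 1 := by rw [hu_eq 0 (by omega)]; exact_mod_cast hp_zero
        simp only [Fin.ext_iff, h, if_true, hu0]
        ring
      · simp only [Fin.ext_iff, h, if_false]
        ring
    · have hrow (j : Fin d) : A i j = 0 := by
        rw [hA, if_neg (by omega), if_neg (by omega)]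
      have hi0 : i ≠ ⟨0, by omega⟩ := fun h => by simp [h] at hi
      simp [hrow, hi0, hu_zero i.val (by omega), hu_zero (i.val + 1) (by omega),
        hu_zero (i.val + 2) (by omega)]
  intro i
  rw [hgrad]
  refine ⟨fun hi => ?_, fun hi => ?_⟩
  · rw [hu_eq _ (by omega), hu_eq _ (by omega), hu_eq _ (by omega)]
    simp only [hp]
    push_cast
    field_simp
    ring
  · simp [hu_zero i.val (by omega), hu_zero (i.val + 1) (by omega),
      hu_zero (i.val + 2) (by omega)]
end

section
/- The initial optimality gap of the Nesterov function satisfies F(0) − F* = L(2t+1)/(16(t+1)), i.e. the infimum of F over ℝ^d equals −L(2t+1)/(16(t+1)). -/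
open Finset in
/-- The quadratic form of a tridiagonal block `(-1, 2, -1)` as a sum of squares of increments. -/
theorem sum_tridiagonal_eq_sum_sq_sub (v : ℕ → ℝ) {d m : ℕ} (hmd : m + 1 ≤ d)
    (A : Matrix (Fin d) (Fin d) ℝ)
    (hA : ∀ i j : Fin d, A i j =
      if i = j ∧ i.val ≤ m then (2 : ℝ)
      else if (i.val = j.val + 1 ∨ j.val = i.val + 1) ∧ i.val ≤ m ∧ j.val ≠ m + 1
        then (-1 : ℝ) else 0) :
    ∑ i : Fin d, ∑ j : Fin d, v i * A i j * v j =
      v 0 ^ 2 + ∑ k ∈ range m, (v k - v (k + 1)) ^ 2 + v m ^ 2 := by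
  have entry : ∀ i j : Fin d, v i * A i j * v j =
      (if (i : ℕ) = j then (if (i : ℕ) < m + 1 then 2 * v i ^ 2 else 0) else 0)
      - (if (i : ℕ) + 1 = j then (if (i : ℕ) < m then v i * v (i + 1) else 0) else 0)
      - (if (j : ℕ) + 1 = i then (if (j : ℕ) < m then v j * v (j + 1) else 0) else 0) := by
    intro i j
    simp only [hA, Fin.ext_iff]
    grind
  have restrict : ∀ (n : ℕ) (f : ℕ → ℝ), n ≤ d →
      ∑ k ∈ range d, (if k < n then f k else 0) = ∑ k ∈ range n, f k := by
    intro n f hn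
    rw [← sum_filter]
    congr 1
    ext k
    simp only [mem_filter, mem_range]
    omega
  have diag : ∑ i : Fin d, ∑ j : Fin d,
      (if (i : ℕ) = j then (if (i : ℕ) < m + 1 then 2 * v i ^ 2 else 0) else 0) =
      ∑ k ∈ range (m + 1), 2 * v k ^ 2 := by
    rw [← restrict _ _ hmd, sum_range]
    refine sum_congr rfl fun i _ => ?_
    simp [← Fin.ext_iff]
  have upper : ∑ i : Fin d, ∑ j : Fin d,
      (if (i : ℕ) + 1 = j then (if (i : ℕ) < m then v i * v (i + 1) else 0) else 0) =
      ∑ k ∈ range m, v k * v (k + 1) := by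
    rw [← restrict _ _ (by omega : m ≤ d), sum_range]
    refine sum_congr rfl fun i _ => ?_
    rw [← sum_range (fun j => if (i : ℕ) + 1 = j then
      (if (i : ℕ) < m then v i * v (i + 1) else 0) else 0), sum_ite_eq]
    grind
  simp only [entry, sum_sub_distrib]
  rw [diag, upper, sum_comm, upper]
  clear entry restrict diag upper hA hmd
  induction m with
  | zero => simp; ring
  | succ m ih =>
    rw [sum_range_succ (fun k => 2 * v k ^ 2), sum_range_succ (fun k => v k * v (k + 1)),
      sum_range_succ (fun k => (v k - v (k + 1)) ^ 2)]
    linear_combination ih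

/-- Cauchy-Schwarz for a path of `m + 1` steps from `1` to `v m`. -/
theorem one_sub_sq_div_le_sum_sq_sub (v : ℕ → ℝ) (m : ℕ) :
    (1 - v m) ^ 2 / (m + 1) ≤
      (1 - v 0) ^ 2 + ∑ k ∈ Finset.range m, (v k - v (k + 1)) ^ 2 := by
  induction m with
  | zero => simp
  | succ m ih =>
    rw [Finset.sum_range_succ, ← add_assoc]
    refine le_trans ?_ (add_le_add_left ih _)
    have hm : (0 : ℝ) < m + 1 := by positivity
    push_cast
    rw [div_add' _ _ _ hm.ne', div_le_div_iff₀ (by positivity) hm]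
    nlinarith [sq_nonneg ((1 - v m) - (m + 1) * (v m - v (m + 1)))]

/-- Initial optimality gap of the Nesterov function:
`F(0) − F* = L(2t+1)/(16(t+1))`, i.e. `inf F = −L(2t+1)/(16(t+1))`. -/
theorem nesterov_initial_gap {d t : ℕ} (ht : 1 ≤ t) (hdt : 2 * t + 1 ≤ d)
    (L : ℝ) (hL : 0 < L)
    (A : Matrix (Fin d) (Fin d) ℝ)
    (hA : ∀ i j : Fin d, A i j =
      if i = j ∧ i.val ≤ 2 * t then (2 : ℝ)
      else if (i.val = j.val + 1 ∨ j.val = i.val + 1) ∧ i.val ≤ 2 * t ∧ j.val ≠ 2 * t + 1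
        then (-1 : ℝ) else 0)
    (F : EuclideanSpace ℝ (Fin d) → ℝ)
    (hF : ∀ w : EuclideanSpace ℝ (Fin d),
      F w = L / 8 * ((∑ i, ∑ j, w i * A i j * w j) - 2 * w ⟨0, by omega⟩))
    (Fstar : ℝ) (hFstar : IsGLB (Set.range F) Fstar) :
    F 0 - Fstar = L * (2 * (t : ℝ) + 1) / (16 * ((t : ℝ) + 1)) ∧
    Fstar = -(L * (2 * (t : ℝ) + 1) / (16 * ((t : ℝ) + 1))) := by
  have value : ∀ v : ℕ → ℝ, F (WithLp.toLp 2 fun i => v i) =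
      L / 8 * ((1 - v 0) ^ 2 + ∑ k ∈ Finset.range (2 * t), (v k - v (k + 1)) ^ 2
        + v (2 * t) ^ 2 - 1) := by
    intro v
    rw [hF]
    simp only [sum_tridiagonal_eq_sum_sq_sub v hdt A hA]
    ring
  have hFstar_eq : Fstar = -(L * (2 * (t : ℝ) + 1) / (16 * ((t : ℝ) + 1))) := by
    refine hFstar.unique (IsLeast.isGLB ⟨?_, ?_⟩)
    · refine ⟨WithLp.toLp 2 fun i => (fun k : ℕ => 1 - ((k : ℝ) + 1) / (2 * t + 2)) i, ?_⟩
      rw [value fun k => 1 - ((k : ℝ) + 1) / (2 * t + 2)]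
      have step : ∀ k ∈ Finset.range (2 * t),
          ((1 - ((k : ℝ) + 1) / (2 * t + 2)) - (1 - (((k + 1 : ℕ) : ℝ) + 1) / (2 * t + 2))) ^ 2 =
            1 / (2 * (t : ℝ) + 2) ^ 2 := by
        intro k _
        push_cast
        field_simp
        ring
      rw [Finset.sum_congr rfl step]
      simp only [Finset.sum_const, Finset.card_range, nsmul_eq_mul]
      push_cast
      field_simp
      ring
    · rintro _ ⟨w, rfl⟩
      let v : ℕ → ℝ := fun k => if h : k < d then w ⟨k, h⟩ else 0
      have hw : w = WithLp.toLp 2 fun i : Fin d => v i := by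
        ext i
        simp [v]
      have path := one_sub_sq_div_le_sum_sq_sub v (2 * t)
      push_cast at path
      have last : 1 / (2 * (t : ℝ) + 2) ≤
          (1 - v (2 * t)) ^ 2 / (2 * t + 1) + v (2 * t) ^ 2 := by
        rw [div_add' _ _ _ (by positivity), div_le_div_iff₀ (by positivity) (by positivity)]
        nlinarith [sq_nonneg ((2 * (t : ℝ) + 2) * v (2 * t) - 1)]
      calc -(L * (2 * (t : ℝ) + 1) / (16 * ((t : ℝ) + 1)))
          = L / 8 * (1 / (2 * (t : ℝ) + 2) - 1) := by
            field_simp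
            ring
        _ ≤ F w := by
            rw [hw, value]
            gcongr
            linarith
  have hF0 : F 0 = 0 := by simp [hF]
  refine ⟨?_, hFstar_eq⟩
  rw [hF0, hFstar_eq]
  ring
end

section
/- Let F : ℝ^d → ℝ be differentiable with L-Lipschitz gradient, let w ∈ ℝ^d, η > 0, and let Δ be a random vector in ℝ^d with finite second moment and mean d̄ = E[Δ]. Then E[F(w − ηΔ)] ≤ F(w) − (η/2)(‖∇F(w)‖² + ‖d̄‖² − ‖d̄ − ∇F(w)‖²) + (η²L/2) E‖Δ‖². -/
open MeasureTheory

/-- A differentiable function with `L`-Lipschitz gradient differs from its first-order Taylor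
polynomial by at most `L / 2 * ‖v‖ ^ 2`. -/
theorem abs_sub_taylor_le_of_gradient_lipschitz {E : Type*} [NormedAddCommGroup E]
    [InnerProductSpace ℝ E] [CompleteSpace E] {F : E → ℝ} {L : ℝ} (hdiff : Differentiable ℝ F)
    (hsmooth : ∀ u v, ‖gradient F u - gradient F v‖ ≤ L * ‖u - v‖) (w v : E) :
    |F (w + v) - F w - inner ℝ (gradient F w) v| ≤ L / 2 * ‖v‖ ^ 2 := by
  have hf (t : ℝ) : HasDerivAt (fun t : ℝ => F (w + t • v) - F w - t * inner ℝ (gradient F w) v)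
      (inner ℝ (gradient F (w + t • v) - gradient F w) v) t := by
    have hline : HasDerivAt (fun t : ℝ => w + t • v) v t := by
      simpa using ((hasDerivAt_id t).smul_const v).const_add w
    have hF := (hdiff (w + t • v)).hasGradientAt.hasFDerivAt.comp_hasDerivAt t hline
    rw [inner_sub_left]
    exact ((hF.sub_const (F w)).sub
      ((hasDerivAt_id t).mul_const (inner ℝ (gradient F w) v))).congr_deriv (by simp)
  have hB (t : ℝ) : HasDerivAt (fun t : ℝ => L / 2 * ‖v‖ ^ 2 * t ^ 2) (L * t * ‖v‖ ^ 2) t := by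
    refine ((hasDerivAt_pow 2 t).const_mul (L / 2 * ‖v‖ ^ 2)).congr_deriv ?_
    norm_num
    ring
  have h := image_norm_le_of_norm_deriv_right_le_deriv_boundary (a := 0) (b := 1)
    (fun t _ => (hf t).continuousAt.continuousWithinAt) (fun t _ => (hf t).hasDerivWithinAt)
    (by simp) hB (fun t ht => ?_) (Set.right_mem_Icc.2 zero_le_one)
  · simpa using h
  · calc ‖inner ℝ (gradient F (w + t • v) - gradient F w) v‖
        ≤ ‖gradient F (w + t • v) - gradient F w‖ * ‖v‖ := norm_inner_le_norm _ _
      _ ≤ L * ‖w + t • v - w‖ * ‖v‖ := by gcongr; exact hsmooth _ _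
      _ = L * t * ‖v‖ ^ 2 := by
        rw [add_sub_cancel_left, norm_smul, Real.norm_of_nonneg ht.1]
        ring

/-- Descent lemma for an `L`-smooth function with a random update direction `Δ`
with mean `d̄`. -/
theorem descent_lemma {Ω : Type*} [MeasurableSpace Ω]
    (μ : Measure Ω) [IsProbabilityMeasure μ]
    {d : ℕ} (F : EuclideanSpace ℝ (Fin d) → ℝ) (L : ℝ)
    (hdiff : Differentiable ℝ F)
    (hsmooth : ∀ u v : EuclideanSpace ℝ (Fin d),
      ‖gradient F u - gradient F v‖ ≤ L * ‖u - v‖)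
    (w : EuclideanSpace ℝ (Fin d)) (η : ℝ) (hη : 0 < η)
    (Δ : Ω → EuclideanSpace ℝ (Fin d))
    (hΔ_int : Integrable Δ μ)
    (hΔ_sq : Integrable (fun ω => ‖Δ ω‖ ^ 2) μ)
    (dbar : EuclideanSpace ℝ (Fin d)) (hdbar : dbar = ∫ ω, Δ ω ∂μ) :
    ∫ ω, F (w - η • Δ ω) ∂μ ≤
      F w - η / 2 * (‖gradient F w‖ ^ 2 + ‖dbar‖ ^ 2 - ‖dbar - gradient F w‖ ^ 2)
        + η ^ 2 * L / 2 * ∫ ω, ‖Δ ω‖ ^ 2 ∂μ := by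
  have htaylor (ω : Ω) : |F (w - η • Δ ω) - F w + η * inner ℝ (gradient F w) (Δ ω)| ≤
      η ^ 2 * L / 2 * ‖Δ ω‖ ^ 2 := by
    have h := abs_sub_taylor_le_of_gradient_lipschitz hdiff hsmooth w (-(η • Δ ω))
    rw [inner_neg_right, inner_smul_right, sub_neg_eq_add, ← sub_eq_add_neg, norm_neg,
      norm_smul, Real.norm_of_nonneg hη.le] at h
    exact h.trans_eq (by ring)
  have hinner : Integrable (fun ω => η * inner ℝ (gradient F w) (Δ ω)) μ :=
    (hΔ_int.const_inner (gradient F w)).const_mul η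
  have hlinear : Integrable (fun ω => F w - η * inner ℝ (gradient F w) (Δ ω)) μ :=
    (integrable_const (F w)).sub hinner
  have hquad : Integrable (fun ω => η ^ 2 * L / 2 * ‖Δ ω‖ ^ 2) μ := hΔ_sq.const_mul _
  have hmeas : AEStronglyMeasurable (fun ω => F (w - η • Δ ω)) μ :=
    hdiff.continuous.comp_aestronglyMeasurable
      (aestronglyMeasurable_const.sub (hΔ_int.aestronglyMeasurable.const_smul η))
  have hF : Integrable (fun ω => F (w - η • Δ ω)) μ := by
    have hrem : Integrable
        (fun ω => F (w - η • Δ ω) - (F w - η * inner ℝ (gradient F w) (Δ ω))) μ := by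
      refine hquad.mono' (hmeas.sub hlinear.aestronglyMeasurable) (ae_of_all _ fun ω => ?_)
      rw [Real.norm_eq_abs, ← sub_add]
      exact htaylor ω
    exact (hrem.add hlinear).congr (ae_of_all _ fun ω => sub_add_cancel _ _)
  have hpolar : ‖gradient F w‖ ^ 2 + ‖dbar‖ ^ 2 - ‖dbar - gradient F w‖ ^ 2 =
      2 * inner ℝ (gradient F w) dbar := by
    rw [norm_sub_sq_real, real_inner_comm]
    ring
  calc ∫ ω, F (w - η • Δ ω) ∂μ
      ≤ ∫ ω, (F w - η * inner ℝ (gradient F w) (Δ ω) + η ^ 2 * L / 2 * ‖Δ ω‖ ^ 2) ∂μ :=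
        integral_mono hF (hlinear.add hquad) fun ω => by
          have h := (abs_le.1 (htaylor ω)).2
          dsimp only
          linarith
    _ = F w - η * inner ℝ (gradient F w) dbar + η ^ 2 * L / 2 * ∫ ω, ‖Δ ω‖ ^ 2 ∂μ := by
        rw [integral_add hlinear hquad, integral_sub (integrable_const _) hinner,
          integral_const_mul, integral_const_mul, integral_inner hΔ_int, ← hdbar]
        simp
    _ = _ := by
        rw [hpolar]
        ring
end
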